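/- Suppose d < δ. Then B_{d+i} ⊆ in(I,g) for every i with i* < i ≤ δ − d. -/

import Mathlib

open MvPolynomial

/-- The total degree of an exponent vector. -/
def expDeg {n : ℕ} (μ : Fin n →₀ ℕ) : ℕ := μ.sum fun _ e => e

/-- Strict degree reverse lexicographic order on exponent vectors, for variables
`x_1 > ⋯ > x_n` (indexed by `Fin n` in this order). -/
def DrlLT {n : ℕ} (a b : Fin n →₀ ℕ) : Prop :=
  expDeg a < expDeg b ∨
    (expDeg a = expDeg b ∧ ∃ i : Fin n, b i < a i ∧ ∀ j : Fin n, i < j → a j = b j)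

/-- `μ` is the leading (degrevlex-largest) exponent of `p`. -/
def IsLeadExp {n : ℕ} {K : Type*} [CommSemiring K] (p : MvPolynomial (Fin n) K)
    (μ : Fin n →₀ ℕ) : Prop :=
  μ ∈ p.support ∧ ∀ ν ∈ p.support, ν ≠ μ → DrlLT ν μ

/-- The initial ideal of `I` with respect to the degree reverse lexicographic order. -/
noncomputable def initialIdeal {n : ℕ} {K : Type*} [CommRing K]
    (I : Ideal (MvPolynomial (Fin n) K)) : Ideal (MvPolynomial (Fin n) K) :=
  Ideal.span { m | ∃ p ∈ I, p ≠ 0 ∧ ∃ μ, IsLeadExp p μ ∧ m = monomial μ (1 : K) }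

/-- The standard monomials of degree `i` of `I` : exponents of the monomials of degree `i`
not lying in the initial ideal of `I`. -/
def stdMon {n : ℕ} {K : Type*} [CommRing K] (I : Ideal (MvPolynomial (Fin n) K)) (i : ℕ) :
    Set (Fin n →₀ ℕ) :=
  { μ | expDeg μ = i ∧ monomial μ (1 : K) ∉ initialIdeal I }

/-- `μ` is a minimal monomial generator of the monomial ideal `M`. -/
def IsMinGen {n : ℕ} {K : Type*} [CommRing K] (M : Ideal (MvPolynomial (Fin n) K))
    (μ : Fin n →₀ ℕ) : Prop :=
  monomial μ (1 : K) ∈ M ∧ ∀ ν : Fin n →₀ ℕ, ν ≤ μ → ν ≠ μ → monomial ν (1 : K) ∉ M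

/-- `μ` satisfies property `P` with respect to the monomial ideal `M`: if `m` is the largest
index of a variable dividing `x^μ`, then every monomial of the same degree in the variables of
index `< m` also lies in `M`. -/
def SatisfiesP {n : ℕ} {K : Type*} [CommRing K] (M : Ideal (MvPolynomial (Fin n) K))
    (μ : Fin n →₀ ℕ) : Prop :=
  ∀ m : Fin n, μ m ≠ 0 → (∀ j : Fin n, m < j → μ j = 0) →
    ∀ ν : Fin n →₀ ℕ, expDeg ν = expDeg μ → (∀ j : Fin n, m ≤ j → ν j = 0) →
      monomial ν (1 : K) ∈ M

/-- Conjecture E (Pardue) holds for the ideal `I`: every minimal generator of the initial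
ideal of `I` satisfies property `P`. -/
def ConjE {n : ℕ} {K : Type*} [CommRing K] (I : Ideal (MvPolynomial (Fin n) K)) : Prop :=
  ∀ μ, IsMinGen (initialIdeal I) μ → SatisfiesP (initialIdeal I) μ

/-- `f` is a generic sequence of forms of degrees `d i` over the base field `F`: each `f i` is
homogeneous of degree `d i` and the family of all coefficients (at all monomials of degree
`d i`) is algebraically independent over `F`. -/
def IsGenericSeq (F : Type*) {K : Type*} [CommRing F] [CommRing K] [Algebra F K]
    {n r : ℕ} (d : Fin r → ℕ) (f : Fin r → MvPolynomial (Fin n) K) : Prop :=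
  (∀ i, (f i).IsHomogeneous (d i)) ∧
    AlgebraicIndependent F
      (fun p : Σ i : Fin r, { μ : Fin n →₀ ℕ // expDeg μ = d i } => (f p.1).coeff p.2.1)

/-- The projection `K[x_1,…,x_n,z] → K[x_1,…,x_n]` sending `z` (the last variable) to `0` and
fixing the other variables. -/
noncomputable def projMap (K : Type*) [CommRing K] (n : ℕ) :
    MvPolynomial (Fin (n + 1)) K →ₐ[K] MvPolynomial (Fin n) K :=
  aeval (fun i => Fin.lastCases 0 (fun j => X j) i)

/-- Embedding of exponent vectors of `K[x_1,…,x_n]` into those of `K[x_1,…,x_n,z]`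
(`z`-exponent `0`). -/
noncomputable def embExp {n : ℕ} (μ : Fin n →₀ ℕ) : Fin (n + 1) →₀ ℕ :=
  Finsupp.embDomain ⟨Fin.castSucc, Fin.castSucc_injective n⟩ μ

/-- Multiplication by `z^c` on exponent vectors in `K[x_1,…,x_n,z]`. -/
noncomputable def zShift {n : ℕ} (c : ℕ) (μ : Fin (n + 1) →₀ ℕ) : Fin (n + 1) →₀ ℕ :=
  μ + Finsupp.single (Fin.last n) c

/-- `f` (homogeneous of degree `e`) is semi-regular on `R/I`: in each degree `t`, the
multiplication map `(R/I)_t → (R/I)_{t+e}` is injective or surjective. -/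
def SemiRegularOn {vars K : Type*} [CommRing K] (I : Ideal (MvPolynomial vars K))
    (f : MvPolynomial vars K) (e : ℕ) : Prop :=
  ∀ t : ℕ,
    (∀ p ∈ homogeneousSubmodule vars K t, f * p ∈ I → p ∈ I) ∨
    (∀ q ∈ homogeneousSubmodule vars K (t + e),
      ∃ p ∈ homogeneousSubmodule vars K t, q - f * p ∈ I)

/-- The degree-`t` graded piece of `R/I`, as a `K`-submodule of the quotient. -/
noncomputable def quotDegPart {vars K : Type*} [CommRing K] (I : Ideal (MvPolynomial vars K))
    (t : ℕ) : Submodule K (MvPolynomial vars K ⧸ I) :=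
  (homogeneousSubmodule vars K t).map (Ideal.Quotient.mkₐ K I).toLinearMap

/-- The ideal `I` contains every form of degree `t`. -/
def ContainsForms {ν K : Type*} [CommRing K] (I : Ideal (MvPolynomial ν K)) (t : ℕ) : Prop :=
  ∀ q : MvPolynomial ν K, q.IsHomogeneous t → q ∈ I

/-- Spanning by vectors depending polynomially on parameters is an open condition. -/
theorem exists_aeval_ne_zero_span_eq_top {F K σ β ι : Type*} [Field F] [Field K] [Algebra F K]
    [Finite β] (v : ι → β → MvPolynomial σ F) (p₀ : σ → K)
    (h : Submodule.span K (Set.range fun c b => aeval p₀ (v c b)) = ⊤) :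
    ∃ P : MvPolynomial σ F, aeval p₀ P ≠ 0 ∧ ∀ p : σ → K, aeval p P ≠ 0 →
      Submodule.span K (Set.range fun c b => aeval p (v c b)) = ⊤ := by
  classical
  have := Fintype.ofFinite β
  obtain ⟨κ, a, -, hspan, hli⟩ := exists_linearIndependent' K (fun c b => aeval p₀ (v c b))
  rw [h] at hspan
  let e : β ≃ κ := (Pi.basisFun K β).indexEquiv (Module.Basis.mk hli hspan.ge)
  have hdet (p : σ → K) : aeval p (Matrix.of fun b => v (a (e b))).det =
      (Matrix.of fun b b' => aeval p (v (a (e b)) b')).det := by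
    rw [AlgHom.map_det]
    rfl
  refine ⟨(Matrix.of fun b => v (a (e b))).det, ?_, fun p hp => ?_⟩
  · rw [hdet, ← isUnit_iff_ne_zero, ← Matrix.isUnit_iff_isUnit_det,
      ← Matrix.linearIndependent_rows_iff_isUnit]
    exact hli.comp e e.injective
  · rw [hdet, ← isUnit_iff_ne_zero, ← Matrix.isUnit_iff_isUnit_det,
      ← Matrix.linearIndependent_rows_iff_isUnit] at hp
    have htop := hp.span_eq_top_of_card_eq_finrank' (by simp)
    rw [eq_top_iff, ← htop]
    refine Submodule.span_mono ?_
    rintro _ ⟨b, rfl⟩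
    exact ⟨a (e b), rfl⟩

theorem finite_degree_eq (n t : ℕ) : Finite { β : Fin n →₀ ℕ // β.degree = t } := by
  refine Set.Finite.to_subtype (s := {β : Fin n →₀ ℕ | β.degree = t})
    (Set.Finite.subset (Finset.finite_toSet (Finset.finsuppAntidiag Finset.univ t)) ?_)
  intro β hβ
  simp only [Set.mem_ofPred_eq] at hβ
  simp [Finset.mem_finsuppAntidiag, ← hβ, Finsupp.degree_eq_sum]

/-- The coefficients of a polynomial in a given degree. -/
noncomputable def coeffsInDegree (K : Type*) [CommRing K] (n t : ℕ) :
    MvPolynomial (Fin n) K →ₗ[K] ({ β : Fin n →₀ ℕ // β.degree = t } → K) :=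
  LinearMap.pi fun β => lcoeff K β.1

@[simp] theorem coeffsInDegree_apply {K : Type*} [CommRing K] {n t : ℕ}
    (q : MvPolynomial (Fin n) K) (β : { β : Fin n →₀ ℕ // β.degree = t }) :
    coeffsInDegree K n t q β = q.coeff β.1 := rfl

theorem homogeneousComponent_mem_span {K ν ι : Type*} [CommRing K]
    (g : ι → MvPolynomial ν K) (hg : ∀ j, ∃ e, (g j).IsHomogeneous e) (t : ℕ)
    {p : MvPolynomial ν K} (hp : p ∈ Ideal.span (Set.range g)) :
    homogeneousComponent t p ∈ Ideal.span (Set.range g) := by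
  let _ := MvPolynomial.gradedAlgebra (R := K) (σ := ν)
  refine homogeneousComponent_mem_of_mem (Ideal.homogeneous_span _ _ ?_) hp t
  rintro _ ⟨j, rfl⟩
  obtain ⟨e, he⟩ := hg j
  exact ⟨e, he⟩

theorem containsForms_span_iff {K ι : Type*} [Field K] [Finite ι] {n : ℕ}
    (g : ι → MvPolynomial (Fin n) K) (hg : ∀ j, ∃ e, (g j).IsHomogeneous e) (t : ℕ) :
    ContainsForms (Ideal.span (Set.range g)) t ↔
      Submodule.span K (Set.range fun c : ι × (Fin n →₀ ℕ) =>
        coeffsInDegree K n t (monomial c.2 1 * g c.1)) = ⊤ := by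
  classical
  have := finite_degree_eq n t
  have := Fintype.ofFinite { β : Fin n →₀ ℕ // β.degree = t }
  have := Fintype.ofFinite ι
  constructor
  · intro h
    rw [eq_top_iff]
    intro x _
    have hq : (∑ β, monomial β.1 (x β) : MvPolynomial (Fin n) K) ∈ Ideal.span (Set.range g) :=
      h _ (IsHomogeneous.sum _ _ _ fun β _ => isHomogeneous_monomial _ β.2)
    have hx : x = coeffsInDegree K n t (∑ β, monomial β.1 (x β)) := by
      ext β
      simp [coeff_sum, coeff_monomial, ← Subtype.ext_iff]
    rw [hx]
    obtain ⟨c, hc⟩ := (Ideal.mem_span_range_iff_exists_fun).1 hq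
    rw [← hc, map_sum]
    refine Submodule.sum_mem _ fun j _ => ?_
    rw [(c j).as_sum, Finset.sum_mul, map_sum]
    refine Submodule.sum_mem _ fun γ _ => ?_
    have : (monomial γ ((c j).coeff γ) * g j : MvPolynomial (Fin n) K) =
        (c j).coeff γ • (monomial γ 1 * g j) := by
      rw [← smul_mul_assoc, smul_monomial, smul_eq_mul, mul_one]
    rw [this, map_smul]
    exact Submodule.smul_mem _ _ (Submodule.subset_span ⟨(j, γ), rfl⟩)
  · intro h q hq
    have hle : Submodule.span K (Set.range fun c : ι × (Fin n →₀ ℕ) =>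
        coeffsInDegree K n t (monomial c.2 1 * g c.1)) ≤
        ((Ideal.span (Set.range g)).restrictScalars K).map (coeffsInDegree K n t) := by
      rw [Submodule.span_le]
      rintro _ ⟨c, rfl⟩
      exact Submodule.mem_map_of_mem (Ideal.mul_mem_left _ _ (Ideal.subset_span ⟨c.1, rfl⟩))
    rw [h] at hle
    obtain ⟨p, hp, hpq⟩ := hle (Submodule.mem_top (x := coeffsInDegree K n t q))
    have : q = homogeneousComponent t p := by
      ext β
      rw [coeff_homogeneousComponent]
      split_ifs with hβ
      · exact (congrFun hpq ⟨β, hβ⟩).symm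
      · exact hq.coeff_eq_zero hβ
    rw [this]
    exact homogeneousComponent_mem_span g hg t hp

/-- Containing all forms of degree `t` is an open condition on the ideals generated by families of
forms depending polynomially on parameters. -/
theorem exists_aeval_ne_zero_containsForms {F K σ ι : Type*} [Field F] [Field K] [Algebra F K]
    [Finite ι] {n : ℕ} (G : ι → MvPolynomial (Fin n) (MvPolynomial σ F))
    (hG : ∀ (p : σ → K) j, ∃ e,
      (map (aeval p : MvPolynomial σ F →ₐ[F] K).toRingHom (G j)).IsHomogeneous e)
    (t : ℕ) (p₀ : σ → K)
    (h : ContainsForms (Ideal.span (Set.range fun j =>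
      map (aeval p₀ : MvPolynomial σ F →ₐ[F] K).toRingHom (G j))) t) :
    ∃ P : MvPolynomial σ F, aeval p₀ P ≠ 0 ∧ ∀ p : σ → K, aeval p P ≠ 0 →
      ContainsForms (Ideal.span (Set.range fun j =>
        map (aeval p : MvPolynomial σ F →ₐ[F] K).toRingHom (G j))) t := by
  have := finite_degree_eq n t
  have key (p : σ → K) : (fun c : ι × (Fin n →₀ ℕ) => coeffsInDegree K n t
      (monomial c.2 1 * map (aeval p : MvPolynomial σ F →ₐ[F] K).toRingHom (G c.1))) =
      fun c (b : { β : Fin n →₀ ℕ // β.degree = t }) =>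
        aeval p (coeff b.1 (monomial c.2 1 * G c.1)) := by
    ext c b
    rw [coeffsInDegree_apply]
    have : (monomial c.2 1 * map (aeval p : MvPolynomial σ F →ₐ[F] K).toRingHom (G c.1)) =
        map (aeval p : MvPolynomial σ F →ₐ[F] K).toRingHom (monomial c.2 1 * G c.1) := by
      simp [map_monomial]
    rw [this, coeff_map]
    rfl
  rw [containsForms_span_iff _ (hG p₀), key] at h
  obtain ⟨P, hP₀, hP⟩ := exists_aeval_ne_zero_span_eq_top _ p₀ h
  refine ⟨P, hP₀, fun p hp => ?_⟩
  rw [containsForms_span_iff _ (hG p), key]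
  exact hP p hp

/-- The linear form with coefficient vector `a`. -/
noncomputable def linearForm {R : Type*} [CommRing R] {n : ℕ} (a : Fin n → R) :
    MvPolynomial (Fin n) R :=
  ∑ i, C (a i) * X i

/-- The product of the linear forms indexed by a finite set. -/
noncomputable def prodLinearForms {R T : Type*} [CommRing R] {n : ℕ} (a : T → Fin n → R)
    (B : Finset T) : MvPolynomial (Fin n) R :=
  ∏ m ∈ B, linearForm (a m)

theorem linearForm_isHomogeneous {R : Type*} [CommRing R] {n : ℕ} (a : Fin n → R) :
    (linearForm a).IsHomogeneous 1 :=
  IsHomogeneous.sum _ _ _ fun _ _ => isHomogeneous_C_mul_X _ _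

theorem prodLinearForms_isHomogeneous {R T : Type*} [CommRing R] {n : ℕ} (a : T → Fin n → R)
    (B : Finset T) : (prodLinearForms a B).IsHomogeneous B.card := by
  simpa [prodLinearForms] using
    IsHomogeneous.prod B _ (fun _ => 1) fun m _ => linearForm_isHomogeneous (a m)

theorem map_linearForm {R S : Type*} [CommRing R] [CommRing S] (φ : R →+* S) {n : ℕ}
    (a : Fin n → R) : map φ (linearForm a) = linearForm fun i => φ (a i) := by
  simp [linearForm]

theorem map_prodLinearForms {R S T : Type*} [CommRing R] [CommRing S] (φ : R →+* S) {n : ℕ}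
    (a : T → Fin n → R) (B : Finset T) :
    map φ (prodLinearForms a B) = prodLinearForms (fun m i => φ (a m i)) B := by
  simp [prodLinearForms, map_linearForm]

theorem map_aeval_prodLinearForms {K T : Type*} [Field K] {n : ℕ} (a : T → Fin n → K)
    (B : Finset T) :
    map (aeval (fun c : T × Fin n => a c.1 c.2) : MvPolynomial (T × Fin n) K →ₐ[K] K).toRingHom
      (prodLinearForms (fun m i => X (m, i)) B) = prodLinearForms a B := by
  simp [map_prodLinearForms]

theorem rename_succ_linearForm {R : Type*} [CommRing R] {n : ℕ} (a : Fin n → R) :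
    rename Fin.succ (linearForm a) = linearForm (Fin.cons 0 a : Fin (n + 1) → R) := by
  simp [linearForm, Fin.sum_univ_succ]

theorem rename_succ_prodLinearForms {R T : Type*} [CommRing R] {n : ℕ} (a : T → Fin n → R)
    (B : Finset T) : rename Fin.succ (prodLinearForms a B) =
      prodLinearForms (fun m => (Fin.cons 0 (a m) : Fin (n + 1) → R)) B := by
  simp [prodLinearForms, rename_succ_linearForm]

theorem linearForm_single_add_smul {R : Type*} [CommRing R] {n : ℕ} (i : Fin n) (τ : R)
    (a : Fin n → R) : linearForm (Pi.single i 1 + τ • a) = X i + C τ * linearForm a := by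
  simp [linearForm, add_mul, Finset.sum_add_distrib, Finset.mul_sum, mul_assoc, Pi.single_apply,
    apply_ite C, ite_mul]

theorem linearForm_single {R : Type*} [CommRing R] {n : ℕ} (i : Fin n) :
    linearForm (Pi.single i (1 : R)) = X i := by
  simp [linearForm, Pi.single_apply, apply_ite C, ite_mul]

/-- Every polynomial is congruent modulo `X 0` to one not involving `X 0`. -/
theorem exists_eq_rename_succ_add_X_zero_mul {R : Type*} [CommRing R] {n : ℕ}
    (q : MvPolynomial (Fin (n + 1)) R) :
    ∃ r, q = rename Fin.succ (aeval (Fin.cons 0 X : Fin (n + 1) → MvPolynomial (Fin n) R) q)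
      + X 0 * r := by
  induction q using MvPolynomial.induction_on with
  | C c => exact ⟨0, by simp⟩
  | add p q hp hq =>
    obtain ⟨r, hr⟩ := hp
    obtain ⟨s, hs⟩ := hq
    refine ⟨r + s, ?_⟩
    rw [map_add, map_add]
    linear_combination hr + hs
  | mul_X p i hp =>
    obtain ⟨r, hr⟩ := hp
    refine Fin.cases ⟨p, by simp [mul_comm]⟩ (fun i => ⟨r * X i.succ, ?_⟩) i
    simp only [map_mul, aeval_X, Fin.cons_succ, rename_X]
    linear_combination hr * X i.succ

theorem isHomogeneous_aeval_cons_zero {R : Type*} [CommRing R] {n t : ℕ}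
    {q : MvPolynomial (Fin (n + 1)) R} (hq : q.IsHomogeneous t) :
    (aeval (Fin.cons 0 X : Fin (n + 1) → MvPolynomial (Fin n) R) q).IsHomogeneous t := by
  have h := hq.aeval (Fin.cons 0 X : Fin (n + 1) → MvPolynomial (Fin n) R) (n := 1)
    (fun i => Fin.cases (by simpa using isHomogeneous_zero _ _ _)
      (fun i => by simpa using isHomogeneous_X _ i) i)
  simpa using h

/-- Forms of degree `t` in one more variable, modulo that variable. -/
theorem containsForms_cons_X_zero {K : Type*} [Field K] {n r t : ℕ}
    (g : Fin r → MvPolynomial (Fin n) K) (h : ContainsForms (Ideal.span (Set.range g)) t) :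
    ContainsForms (Ideal.span (Set.range (Fin.cons (X 0) fun j => rename Fin.succ (g j) :
      Fin (r + 1) → MvPolynomial (Fin (n + 1)) K))) t := by
  intro q hq
  obtain ⟨s, hs⟩ := exists_eq_rename_succ_add_X_zero_mul q
  rw [hs]
  refine Ideal.add_mem _ ?_ (Ideal.mul_mem_right _ _ (Ideal.subset_span ⟨0, rfl⟩))
  have hmem := Ideal.mem_map_of_mem (rename (R := K) (Fin.succ (n := n)))
    (h _ (isHomogeneous_aeval_cons_zero hq))
  rw [Ideal.map_span] at hmem
  refine Ideal.span_mono ?_ hmem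
  rintro _ ⟨_, ⟨j, rfl⟩, rfl⟩
  exact ⟨j.succ, by simp⟩

theorem containsForms_of_one_mem {K ν : Type*} [Field K] {I : Ideal (MvPolynomial ν K)}
    (h : (1 : MvPolynomial ν K) ∈ I) (t : ℕ) : ContainsForms I t := fun q _ => by
  rw [(Ideal.eq_top_iff_one I).2 h]
  trivial

theorem homogeneousComponent_succ_X_mul {K ν : Type*} [CommRing K] (i : ν) (c : MvPolynomial ν K)
    (t : ℕ) : homogeneousComponent (t + 1) (X i * c) = X i * homogeneousComponent t c := by
  classical
  ext β
  rw [coeff_homogeneousComponent, coeff_X_mul', coeff_X_mul', coeff_homogeneousComponent]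
  by_cases hi : i ∈ β.support
  · have hβ : β = β - Finsupp.single i 1 + Finsupp.single i 1 := by
      rw [tsub_add_cancel_of_le]
      rw [Finsupp.single_le_iff]
      exact Nat.one_le_iff_ne_zero.2 (Finsupp.mem_support_iff.1 hi)
    have hdeg : β.degree = (β - Finsupp.single i 1).degree + 1 := by
      conv_lhs => rw [hβ, map_add, Finsupp.degree_single]
    simp [hi, hdeg]
  · simp [hi]

/-- If the ideals `(u, v, h)` and `(X i, p, h)` contain all forms of degree `t` and `t + 1`
respectively, then `(X i * u, X i * v, p, h)` contains all forms of degree `t + 1`. -/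
theorem containsForms_X_mul {K ν : Type*} [Field K] {r t : ℕ} (i : ν) (u v p : MvPolynomial ν K)
    (h : Fin r → MvPolynomial ν K) (hp : ∃ e, p.IsHomogeneous e)
    (hh : ∀ j, ∃ e, (h j).IsHomogeneous e)
    (h₁ : ContainsForms (Ideal.span (Set.range (Fin.cons u (Fin.cons v h) :
      Fin (r + 2) → MvPolynomial ν K))) t)
    (h₂ : ContainsForms (Ideal.span (Set.range (Fin.cons (X i) (Fin.cons p h) :
      Fin (r + 2) → MvPolynomial ν K))) (t + 1)) :
    ContainsForms (Ideal.span (Set.range (Fin.cons (X i * u) (Fin.cons (X i * v) (Fin.cons p h)) :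
      Fin (r + 3) → MvPolynomial ν K))) (t + 1) := by
  intro q hq
  obtain ⟨c, hc⟩ := Ideal.mem_span_range_iff_exists_fun.1 (h₂ q hq)
  rw [Fin.sum_univ_succ] at hc
  simp only [Fin.cons_zero, Fin.cons_succ] at hc
  have hmem : q - X i * c 0 ∈ Ideal.span (Set.range (Fin.cons p h :
      Fin (r + 1) → MvPolynomial ν K)) :=
    Ideal.mem_span_range_iff_exists_fun.2 ⟨fun j => c j.succ, by linear_combination hc⟩
  have hcomp := homogeneousComponent_mem_span _ (Fin.cases hp hh) (t + 1) hmem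
  rw [map_sub, homogeneousComponent_succ_X_mul, homogeneousComponent_eq_self hq] at hcomp
  obtain ⟨b, hb⟩ := Ideal.mem_span_range_iff_exists_fun.1
    (h₁ _ (homogeneousComponent_isHomogeneous t (c 0)))
  obtain ⟨d, hd⟩ := Ideal.mem_span_range_iff_exists_fun.1 hcomp
  simp only [Fin.sum_univ_succ, Fin.cons_zero, Fin.cons_succ] at hb hd
  refine Ideal.mem_span_range_iff_exists_fun.2 ⟨Fin.cons (b 0) (Fin.cons (b (Fin.succ 0))
    (Fin.cons (d 0) fun j => X i * b j.succ.succ + d j.succ)), ?_⟩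
  simp only [Fin.sum_univ_succ, Fin.cons_zero, Fin.cons_succ, add_mul, Finset.sum_add_distrib,
    mul_assoc, ← Finset.mul_sum]
  linear_combination hd + X i * hb

theorem exists_eval_ne_zero {K σ : Type*} [Field K] [Infinite K] {P : MvPolynomial σ K}
    (hP : P ≠ 0) : ∃ p : σ → K, eval p P ≠ 0 := by
  by_contra! h
  exact hP (MvPolynomial.funext fun x => by simpa using h x)

/-- The degeneration `(X i + τ w) u, X i v ⟶ X i u, X i v, w u v` as `τ → 0`. -/
theorem exists_containsForms_deformation {K : Type*} [Field K] [Infinite K] {n r t : ℕ}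
    (i : Fin n) (u v w : MvPolynomial (Fin n) K) (h : Fin r → MvPolynomial (Fin n) K)
    (hu : ∃ e, u.IsHomogeneous e) (hv : ∃ e, v.IsHomogeneous e) (hw : w.IsHomogeneous 1)
    (hh : ∀ j, ∃ e, (h j).IsHomogeneous e)
    (h₀ : ContainsForms (Ideal.span (Set.range (Fin.cons (X i * u) (Fin.cons (X i * v)
      (Fin.cons (w * u * v) h)) : Fin (r + 3) → MvPolynomial (Fin n) K))) t) :
    ∃ τ : K, ContainsForms (Ideal.span (Set.range (Fin.cons ((X i + C τ * w) * u)
      (Fin.cons (X i * v) h) : Fin (r + 2) → MvPolynomial (Fin n) K))) t := by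
  obtain ⟨eu, hu⟩ := hu
  obtain ⟨ev, hv⟩ := hv
  let G : Fin (r + 3) → MvPolynomial (Fin n) (MvPolynomial Unit K) :=
    Fin.cons ((X i + C (X ()) * map C w) * map C u) (Fin.cons (X i * map C v)
      (Fin.cons (map C (w * u * v)) fun j => map C (h j)))
  let H (τ : K) : Fin (r + 3) → MvPolynomial (Fin n) K :=
    Fin.cons ((X i + C τ * w) * u) (Fin.cons (X i * v) (Fin.cons (w * u * v) h))
  have hmapC (p : Unit → K) (q : MvPolynomial (Fin n) K) :
      map (aeval p : MvPolynomial Unit K →ₐ[K] K).toRingHom (map C q) = q := by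
    rw [map_map]
    convert map_id q
    ext x
    simp
  have hGH (p : Unit → K) :
      (fun j => map (aeval p : MvPolynomial Unit K →ₐ[K] K).toRingHom (G j)) = H (p ()) := by
    ext1 j
    refine Fin.cases ?_ (Fin.cases ?_ (Fin.cases ?_ fun j => ?_)) j
    · simp only [G, H, Fin.cons_zero, map_mul, map_add, hmapC, map_X, map_C]
      simp
    · simp only [G, H, Fin.cons_zero, Fin.cons_succ, map_mul, hmapC, map_X]
    · simp only [G, H, Fin.cons_zero, Fin.cons_succ, hmapC]
    · simp only [G, H, Fin.cons_succ, hmapC]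
  have hH (τ : K) (j) : ∃ e, (H τ j).IsHomogeneous e := by
    refine Fin.cases ?_ (Fin.cases ?_ (Fin.cases ?_ fun j => ?_)) j
    · exact ⟨_, ((isHomogeneous_X K i).add (hw.C_mul τ)).mul hu⟩
    · exact ⟨_, (isHomogeneous_X K i).mul hv⟩
    · exact ⟨_, (hw.mul hu).mul hv⟩
    · exact hh j
  have hzero : H 0 = Fin.cons (X i * u) (Fin.cons (X i * v) (Fin.cons (w * u * v) h)) := by
    simp [H]
  obtain ⟨P, hP₀, hP⟩ := exists_aeval_ne_zero_containsForms G
    (fun p j => by simpa only [← hGH p] using hH (p ()) j) t (fun _ => (0 : K))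
    (by rw [hGH, hzero]; exact h₀)
  have hne : P * X () ≠ 0 := mul_ne_zero (fun h => hP₀ (by simp [h])) (X_ne_zero _)
  obtain ⟨p, hp⟩ := exists_eval_ne_zero hne
  rw [map_mul, eval_X] at hp
  have hτ : p () ≠ 0 := right_ne_zero_of_mul hp
  refine ⟨p (), fun q hq => ?_⟩
  have hq' := hP p (by simpa [aeval_eq_eval] using left_ne_zero_of_mul hp) q hq
  rw [hGH] at hq'
  refine (Ideal.span_le.2 ?_) hq'
  have hmem (j) := Ideal.subset_span (Set.mem_range_self (f := (Fin.cons ((X i + C (p ()) * w) * u)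
      (Fin.cons (X i * v) h) : Fin (r + 2) → MvPolynomial (Fin n) K)) j)
  rintro _ ⟨j, rfl⟩
  refine Fin.cases ?_ (Fin.cases ?_ (Fin.cases ?_ fun j => ?_)) j
  · exact hmem 0
  · exact hmem (Fin.succ 0)
  · have heq : w * u * v = C (p ())⁻¹ * (v * ((X i + C (p ()) * w) * u) - u * (X i * v)) := by
      have : (C (p ())⁻¹ * C (p ()) : MvPolynomial (Fin n) K) = 1 := by
        rw [← C_mul, inv_mul_cancel₀ hτ, C_1]
      linear_combination (-(w * u * v)) * this
    have h0 := hmem 0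
    have h1 := hmem (Fin.succ 0)
    simp only [Fin.cons_zero, Fin.cons_succ] at h0 h1
    simp only [H, Fin.cons_zero, Fin.cons_succ, SetLike.mem_coe]
    rw [heq]
    exact Ideal.mul_mem_left _ _ (Ideal.sub_mem _ (Ideal.mul_mem_left _ _ h0)
      (Ideal.mul_mem_left _ _ h1))
  · exact hmem j.succ.succ

/-- For families of products of linear forms, two realizable conditions of containing all forms of
some degree, one of them modulo the first variable, can be realized simultaneously. -/
theorem exists_containsForms_and {K T : Type*} [Field K] [Infinite K] {n r₁ r₂ t₁ t₂ : ℕ}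
    (B₁ : Fin r₁ → Finset T) (B₂ : Fin r₂ → Finset T)
    (h₁ : ∃ a : T → Fin (n + 1) → K,
      ContainsForms (Ideal.span (Set.range fun j => prodLinearForms a (B₁ j))) t₁)
    (h₂ : ∃ a : T → Fin n → K,
      ContainsForms (Ideal.span (Set.range fun j => prodLinearForms a (B₂ j))) t₂) :
    ∃ a : T → Fin (n + 1) → K,
      ContainsForms (Ideal.span (Set.range fun j => prodLinearForms a (B₁ j))) t₁ ∧
      ContainsForms (Ideal.span (Set.range (Fin.cons (X 0) fun j => prodLinearForms a (B₂ j) :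
        Fin (r₂ + 1) → MvPolynomial (Fin (n + 1)) K))) t₂ := by
  obtain ⟨a₁, h₁⟩ := h₁
  obtain ⟨a₂, h₂⟩ := h₂
  have h₂ := containsForms_cons_X_zero _ h₂
  simp only [rename_succ_prodLinearForms] at h₂
  let gen : T → Fin (n + 1) → MvPolynomial (T × Fin (n + 1)) K := fun m i => X (m, i)
  have hgen (p : T × Fin (n + 1) → K) (B : Finset T) :
      map (aeval p : MvPolynomial (T × Fin (n + 1)) K →ₐ[K] K).toRingHom (prodLinearForms gen B) =
        prodLinearForms (fun m i => p (m, i)) B :=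
    map_aeval_prodLinearForms (fun m i => p (m, i)) B
  have hcons (p : T × Fin (n + 1) → K) :
      (fun j => map (aeval p : MvPolynomial (T × Fin (n + 1)) K →ₐ[K] K).toRingHom
        ((Fin.cons (X 0) fun j => prodLinearForms gen (B₂ j) : Fin (r₂ + 1) →
          MvPolynomial (Fin (n + 1)) (MvPolynomial (T × Fin (n + 1)) K)) j)) =
      Fin.cons (X 0) fun j => prodLinearForms (fun m i => p (m, i)) (B₂ j) := by
    ext1 j
    refine Fin.cases ?_ (fun j => ?_) j
    · simp only [Fin.cons_zero, map_X]
    · simp only [Fin.cons_succ, hgen]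
  obtain ⟨P, hP₀, hP⟩ := exists_aeval_ne_zero_containsForms
    (fun j => prodLinearForms gen (B₁ j))
    (fun p j => ⟨_, by rw [hgen]; exact prodLinearForms_isHomogeneous _ _⟩) t₁
    (fun c => a₁ c.1 c.2) (by simpa only [hgen] using h₁)
  obtain ⟨Q, hQ₀, hQ⟩ := exists_aeval_ne_zero_containsForms
    (Fin.cons (X 0) fun j => prodLinearForms gen (B₂ j) : Fin (r₂ + 1) →
          MvPolynomial (Fin (n + 1)) (MvPolynomial (T × Fin (n + 1)) K))
    (fun p j => by
      rw [congrFun (hcons p) j]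
      refine Fin.cases ?_ (fun j => ?_) j
      · exact ⟨_, isHomogeneous_X _ _⟩
      · exact ⟨_, prodLinearForms_isHomogeneous _ _⟩)
    t₂ (fun c => (Fin.cons 0 (a₂ c.1) : Fin (n + 1) → K) c.2) (by rw [hcons]; exact h₂)
  have hne : P * Q ≠ 0 :=
    mul_ne_zero (fun h => hP₀ (by simp [h])) (fun h => hQ₀ (by simp [h]))
  obtain ⟨p, hp⟩ := exists_eval_ne_zero hne
  rw [map_mul] at hp
  refine ⟨fun m i => p (m, i), ?_, ?_⟩
  · have := hP p (by simpa [aeval_eq_eval] using left_ne_zero_of_mul hp)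
    simpa only [hgen] using this
  · have := hQ p (by simpa [aeval_eq_eval] using right_ne_zero_of_mul hp)
    rwa [hcons] at this

/-- Over an infinite field of any characteristic, there are `n + 1` products of linear forms in `n`
variables, of prescribed degrees of sum `N`, generating an ideal which contains all forms of
degree `t` as soon as `N ≤ 2 * t + n`. -/
theorem exists_prodLinearForms_containsForms {K T : Type*} [Field K] [Infinite K] (N n : ℕ)
    (B : Fin (n + 1) → Finset T) (hdisj : Pairwise fun i j => Disjoint (B i) (B j))
    (hN : ∑ j, (B j).card = N) (t : ℕ) (ht : N ≤ 2 * t + n) :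
    ∃ a : T → Fin n → K,
      ContainsForms (Ideal.span (Set.range fun j => prodLinearForms a (B j))) t := by
  classical
  induction N using Nat.strong_induction_on generalizing n t with
  | _ N ih =>
  by_cases hempty : ∃ j, B j = ∅
  · obtain ⟨j, hj⟩ := hempty
    refine ⟨0, containsForms_of_one_mem (Ideal.subset_span (Set.mem_range.2 ⟨j, ?_⟩)) t⟩
    simp [hj, prodLinearForms]
  push Not at hempty
  have hcard (j) : 1 ≤ (B j).card := Finset.card_pos.2 (hempty j)
  have htpos : 1 ≤ t := by
    have := Finset.sum_le_sum fun j (_ : j ∈ Finset.univ) => hcard j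
    simp only [Finset.sum_const, Finset.card_univ, Fintype.card_fin, smul_eq_mul, mul_one] at this
    omega
  obtain ⟨t, rfl⟩ := Nat.exists_eq_add_of_le' htpos
  cases n with
  | zero =>
    refine ⟨0, fun q hq => ?_⟩
    have : q = 0 := by
      by_contra hne
      have := (isHomogeneous_of_isEmpty _ _ q).inj_right hq hne
      omega
    rw [this]
    exact Ideal.zero_mem _
  | succ n =>
    obtain ⟨m₁, hm₁⟩ := hempty 0
    obtain ⟨m₂, hm₂⟩ := hempty (Fin.succ 0)
    set U := (B 0).erase m₁ with hU
    set V := (B (Fin.succ 0)).erase m₂ with hV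
    let B₁ : Fin (n + 2) → Finset T := Fin.cons U (Fin.cons V fun j => B j.succ.succ)
    let B₂ : Fin (n + 1) → Finset T := Fin.cons (B 0 ∪ V) fun j => B j.succ.succ
    have hUcard : U.card + 1 = (B 0).card := Finset.card_erase_add_one hm₁
    have hVcard : V.card + 1 = (B (Fin.succ 0)).card := Finset.card_erase_add_one hm₂
    have hVB : V ⊆ B (Fin.succ 0) := Finset.erase_subset _ _
    have h01 : Disjoint (B 0) (B (Fin.succ 0)) := hdisj (Fin.succ_ne_zero _).symm
    have h0V : Disjoint (B 0) V := h01.mono_right hVB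
    have hrest0 (j : Fin n) : Disjoint (B 0) (B j.succ.succ) := hdisj (Fin.succ_ne_zero _).symm
    have hrest1 (j : Fin n) : Disjoint (B (Fin.succ 0)) (B j.succ.succ) :=
      hdisj fun h => Fin.succ_ne_zero j (Fin.succ_injective _ h).symm
    rw [Fin.sum_univ_succ, Fin.sum_univ_succ] at hN
    have hB₁ (j) : B₁ j ⊆ B j := by
      refine Fin.cases (Finset.erase_subset _ _) (Fin.cases hVB fun j => ?_) j
      exact Finset.Subset.refl _
    obtain ⟨a, ha₁, ha₂⟩ := exists_containsForms_and (K := K) B₁ B₂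
      (ih (N - 2) (by omega) (n + 1) B₁ (fun i j hij => (hdisj hij).mono (hB₁ i) (hB₁ j))
        (by
          simp only [B₁, Fin.sum_univ_succ, Fin.cons_zero, Fin.cons_succ]
          omega) t (by omega))
      (ih (N - 1) (by omega) n B₂
        (by
          have hstep (j : Fin n) : Disjoint (B 0 ∪ V) (B j.succ.succ) :=
            Finset.disjoint_union_left.2 ⟨hrest0 j, (hrest1 j).mono_left hVB⟩
          intro i j
          refine Fin.cases (Fin.cases (fun h => (h rfl).elim) (fun j _ => hstep j) j)
            (fun i => Fin.cases (fun _ => (hstep i).symm) (fun j hij => ?_) j) i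
          exact hdisj fun h => hij (Fin.succ_injective _ h))
        (by
          simp only [B₂, Fin.sum_univ_succ, Fin.cons_zero, Fin.cons_succ,
            Finset.card_union_of_disjoint h0V]
          omega) (t + 1) (by omega))
    have hrest (j : Fin n) : ∃ e, (prodLinearForms a (B j.succ.succ)).IsHomogeneous e :=
      ⟨_, prodLinearForms_isHomogeneous _ _⟩
    have hprod : prodLinearForms a (B 0 ∪ V) =
        linearForm (a m₁) * prodLinearForms a U * prodLinearForms a V := by
      rw [prodLinearForms, Finset.prod_union h0V, ← Finset.mul_prod_erase _ _ hm₁]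
      rfl
    have hfam₁ : (fun j => prodLinearForms a (B₁ j)) = Fin.cons (prodLinearForms a U)
        (Fin.cons (prodLinearForms a V) fun j => prodLinearForms a (B j.succ.succ)) := by
      ext1 j
      exact Fin.cases rfl (Fin.cases rfl fun j => rfl) j
    have hfam₂ : (fun j => prodLinearForms a (B₂ j)) = Fin.cons
        (linearForm (a m₁) * prodLinearForms a U * prodLinearForms a V)
        fun j => prodLinearForms a (B j.succ.succ) := by
      ext1 j
      exact Fin.cases hprod (fun j => rfl) j
    rw [hfam₁] at ha₁
    rw [hfam₂] at ha₂
    obtain ⟨τ, hτ⟩ := exists_containsForms_deformation 0 (prodLinearForms a U)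
      (prodLinearForms a V) (linearForm (a m₁)) _ ⟨_, prodLinearForms_isHomogeneous _ _⟩
      ⟨_, prodLinearForms_isHomogeneous _ _⟩ (linearForm_isHomogeneous _) hrest
      (containsForms_X_mul 0 _ _ _ _
        ⟨_, ((linearForm_isHomogeneous _).mul (prodLinearForms_isHomogeneous _ _)).mul
          (prodLinearForms_isHomogeneous _ _)⟩ hrest ha₁ ha₂)
    let b : T → Fin (n + 1) → K := fun m =>
      if m = m₁ then Pi.single 0 1 + τ • a m₁ else if m = m₂ then Pi.single 0 1 else a m
    have hb₁ : linearForm (b m₁) = X 0 + C τ * linearForm (a m₁) := by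
      simp only [b, if_true, linearForm_single_add_smul]
    have hne : m₂ ≠ m₁ := fun h => Finset.disjoint_left.1 h01 hm₁ (h ▸ hm₂)
    have hb₂ : linearForm (b m₂) = X 0 := by
      simp only [b, if_neg hne, if_true, linearForm_single]
    have hb (S : Finset T) (h₁ : m₁ ∉ S) (h₂ : m₂ ∉ S) :
        prodLinearForms b S = prodLinearForms a S := by
      refine Finset.prod_congr rfl fun m hm => ?_
      simp only [b, if_neg (ne_of_mem_of_not_mem hm h₁), if_neg (ne_of_mem_of_not_mem hm h₂)]
    refine ⟨b, ?_⟩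
    convert hτ using 3
    ext1 j
    refine Fin.cases ?_ (Fin.cases ?_ fun j => ?_) j
    · simp only [Fin.cons_zero]
      rw [← hb U (Finset.notMem_erase _ _)
        (fun h => Finset.disjoint_left.1 h01 (Finset.mem_of_mem_erase h) hm₂), ← hb₁]
      exact (Finset.mul_prod_erase _ _ hm₁).symm
    · simp only [Fin.cons_zero, Fin.cons_succ]
      rw [← hb V (fun h => Finset.disjoint_left.1 h0V hm₁ h) (Finset.notMem_erase _ _), ← hb₂]
      exact (Finset.mul_prod_erase _ _ hm₂).symm
    · simp only [Fin.cons_succ]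
      exact hb _ (Finset.disjoint_left.1 (hrest0 j) hm₁) (Finset.disjoint_left.1 (hrest1 j) hm₂)

/-- Substituting the coefficients of a form into the form with indeterminate coefficients. -/
theorem map_aeval_sum_monomial_X {F K ι : Type*} [Field F] [Field K] [Algebra F K] {n : ℕ}
    (e : ι → ℕ) (j : ι) [Fintype { ν : Fin n →₀ ℕ // ν.degree = e j }]
    (q : MvPolynomial (Fin n) K) (hq : q.IsHomogeneous (e j))
    (c : (Σ j, { ν : Fin n →₀ ℕ // ν.degree = e j }) → K) (hc : ∀ ν, c ⟨j, ν⟩ = q.coeff ν.1) :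
    map (aeval c : MvPolynomial (Σ j, { ν : Fin n →₀ ℕ // ν.degree = e j }) F →ₐ[F] K).toRingHom
      (∑ ν : { ν : Fin n →₀ ℕ // ν.degree = e j }, monomial ν.1 (X ⟨j, ν⟩)) = q := by
  classical
  ext β
  simp only [map_sum, map_monomial, coeff_sum, coeff_monomial]
  by_cases hβ : β.degree = e j
  · rw [Finset.sum_eq_single ⟨β, hβ⟩]
    · simp [hc]
    · intro ν _ hν
      rw [if_neg fun h => hν (Subtype.ext h)]
    · simp
  · rw [hq.coeff_eq_zero hβ]
    refine Finset.sum_eq_zero fun ν _ => if_neg ?_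
    rintro rfl
    exact hβ ν.2

/-- Forms with algebraically independent coefficients over `F` generate an ideal containing all
forms of degree `t`, as soon as this happens for some forms of the same degrees over `K`. -/
theorem containsForms_of_algebraicIndependent {F K ι : Type*} [Field F] [Field K] [Algebra F K]
    [Finite ι] {n t : ℕ} (e : ι → ℕ) (q : ι → MvPolynomial (Fin n) K)
    (hq : ∀ j, (q j).IsHomogeneous (e j))
    (hind : AlgebraicIndependent F
      fun c : Σ j, { ν : Fin n →₀ ℕ // ν.degree = e j } => (q c.1).coeff c.2.1)
    (q₀ : ι → MvPolynomial (Fin n) K) (hq₀ : ∀ j, (q₀ j).IsHomogeneous (e j))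
    (h : ContainsForms (Ideal.span (Set.range q₀)) t) :
    ContainsForms (Ideal.span (Set.range q)) t := by
  classical
  have (j : ι) : Finite { ν : Fin n →₀ ℕ // ν.degree = e j } := finite_degree_eq n (e j)
  let _ (j : ι) : Fintype { ν : Fin n →₀ ℕ // ν.degree = e j } :=
    Fintype.ofFinite { ν : Fin n →₀ ℕ // ν.degree = e j }
  let G (j : ι) : MvPolynomial (Fin n)
      (MvPolynomial (Σ j, { ν : Fin n →₀ ℕ // ν.degree = e j }) F) :=
    ∑ ν : { ν : Fin n →₀ ℕ // ν.degree = e j }, monomial ν.1 (X ⟨j, ν⟩)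
  have hG (q : ι → MvPolynomial (Fin n) K) (hq : ∀ j, (q j).IsHomogeneous (e j)) (j : ι) :
      map (aeval fun c : Σ j, { ν : Fin n →₀ ℕ // ν.degree = e j } => (q c.1).coeff c.2.1 :
        MvPolynomial (Σ j, { ν : Fin n →₀ ℕ // ν.degree = e j }) F →ₐ[F] K).toRingHom (G j) =
        q j :=
    map_aeval_sum_monomial_X e j (q j) (hq j) _ fun _ => rfl
  obtain ⟨P, hP₀, hP⟩ := exists_aeval_ne_zero_containsForms (F := F) (K := K) G
    (fun p j => ⟨e j, by
      simp only [G, map_sum, map_monomial]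
      exact IsHomogeneous.sum _ _ _ fun ν _ => isHomogeneous_monomial _ ν.2⟩) t
    (fun c => (q₀ c.1).coeff c.2.1) (by simpa only [hG q₀ hq₀] using h)
  have hPne : P ≠ 0 := fun h => hP₀ (by simp [h])
  have := hP (fun c => (q c.1).coeff c.2.1)
    fun h => hPne ((injective_iff_map_eq_zero _).1 hind P h)
  simpa only [hG q hq] using this

theorem embExp_castSucc {n : ℕ} (μ : Fin n →₀ ℕ) (i : Fin n) : embExp μ i.castSucc = μ i :=
  Finsupp.embDomain_apply_self _ _ _

theorem embExp_last {n : ℕ} (μ : Fin n →₀ ℕ) : embExp μ (Fin.last n) = 0 :=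
  Finsupp.embDomain_of_notMem_range _ _ _ (by
    rintro ⟨i, hi⟩
    exact (Fin.castSucc_lt_last i).ne hi)

theorem embExp_injective {n : ℕ} : Function.Injective (embExp (n := n)) :=
  Finsupp.embDomain_injective _

theorem degree_embExp {n : ℕ} (μ : Fin n →₀ ℕ) : (embExp μ).degree = μ.degree := by
  rw [Finsupp.degree_eq_sum, Finsupp.degree_eq_sum, Fin.sum_univ_castSucc, embExp_last, add_zero]
  simp only [embExp_castSucc]

theorem exists_eq_embExp {n : ℕ} {ν : Fin (n + 1) →₀ ℕ} (h : ν (Fin.last n) = 0) :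
    ∃ μ, ν = embExp μ := by
  refine ⟨Finsupp.equivFunOnFinite.symm fun i => ν i.castSucc, ?_⟩
  ext i
  refine Fin.lastCases ?_ (fun i => ?_) i
  · rw [h, embExp_last]
  · rw [embExp_castSucc]
    rfl

theorem projMap_monomial_embExp {K : Type*} [CommRing K] {n : ℕ} (μ : Fin n →₀ ℕ) (c : K) :
    projMap K n (monomial (embExp μ) c) = monomial μ c := by
  rw [projMap, aeval_monomial, Finsupp.prod_fintype _ _ (by simp), Fin.prod_univ_castSucc,
    embExp_last, monomial_eq, Finsupp.prod_fintype _ _ (by simp)]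
  simp [embExp_castSucc]

theorem projMap_monomial_of_ne_zero {K : Type*} [CommRing K] {n : ℕ} {ν : Fin (n + 1) →₀ ℕ}
    (h : ν (Fin.last n) ≠ 0) (c : K) : projMap K n (monomial ν c) = 0 := by
  rw [projMap, aeval_monomial, Finsupp.prod_fintype _ _ (by simp), Fin.prod_univ_castSucc]
  simp [h]

theorem coeff_projMap {K : Type*} [CommRing K] {n : ℕ} (p : MvPolynomial (Fin (n + 1)) K)
    (μ : Fin n →₀ ℕ) : (projMap K n p).coeff μ = p.coeff (embExp μ) := by
  classical
  induction p using MvPolynomial.induction_on' with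
  | add p q hp hq => rw [map_add, coeff_add, coeff_add, hp, hq]
  | monomial ν c =>
    by_cases h : ν (Fin.last n) = 0
    · obtain ⟨ν, rfl⟩ := exists_eq_embExp h
      rw [projMap_monomial_embExp, coeff_monomial, coeff_monomial]
      simp only [embExp_injective.eq_iff]
    · rw [projMap_monomial_of_ne_zero h, coeff_zero, coeff_monomial, if_neg]
      rintro rfl
      exact h (embExp_last μ)

theorem projMap_isHomogeneous {K : Type*} [CommRing K] {n e : ℕ}
    {p : MvPolynomial (Fin (n + 1)) K} (hp : p.IsHomogeneous e) :
    (projMap K n p).IsHomogeneous e := by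
  intro μ hμ
  rw [coeff_projMap] at hμ
  have := hp hμ
  rw [Pi.one_def] at this ⊢
  rwa [← Finsupp.degree_eq_weight_one, ← degree_embExp, Finsupp.degree_eq_weight_one]

theorem projMap_surjective {K : Type*} [CommRing K] {n : ℕ} :
    Function.Surjective (projMap K n) := fun q => by
  refine ⟨rename Fin.castSucc q, ?_⟩
  rw [projMap, aeval_rename]
  have : ((fun i => Fin.lastCases 0 (fun j => X j) i :
      Fin (n + 1) → MvPolynomial (Fin n) K) ∘ Fin.castSucc) = X := by
    ext1 i
    simp
  rw [this, aeval_X_left_apply]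

/-- The specializations at `z = 0` of generic forms have algebraically independent coefficients. -/
theorem IsGenericSeq.algebraicIndependent_projMap {F K : Type*} [CommRing F] [CommRing K]
    [Algebra F K] {n r : ℕ} {d : Fin r → ℕ} {f : Fin r → MvPolynomial (Fin (n + 1)) K}
    (hf : IsGenericSeq F d f) :
    AlgebraicIndependent F fun c : Σ j, { ν : Fin n →₀ ℕ // ν.degree = d j } =>
      (projMap K n (f c.1)).coeff c.2.1 := by
  simp only [coeff_projMap]
  refine hf.2.comp (fun c : Σ j, { ν : Fin n →₀ ℕ // ν.degree = d j } =>
    (⟨c.1, embExp c.2.1, (degree_embExp _).trans c.2.2⟩ :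
      Σ j, { μ : Fin (n + 1) →₀ ℕ // expDeg μ = d j })) ?_
  rintro ⟨i, ν, hν⟩ ⟨j, ν', hν'⟩ h
  obtain rfl : i = j := congrArg Sigma.fst h
  have h' := eq_of_heq (Sigma.mk.inj h).2
  obtain rfl : ν = ν' := embExp_injective (congrArg Subtype.val h')
  rfl

/-- A monomial in `x_1, …, x_n` lies in the initial ideal of a homogeneous ideal as soon as it lies
in the ideal modulo `z`. -/
theorem monomial_embExp_mem_initialIdeal {K ι : Type*} [Field K] {n : ℕ}
    (q : ι → MvPolynomial (Fin (n + 1)) K) (hq : ∀ j, ∃ e, (q j).IsHomogeneous e)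
    {μ : Fin n →₀ ℕ} (h : monomial μ (1 : K) ∈ Ideal.span (Set.range fun j => projMap K n (q j))) :
    monomial (embExp μ) (1 : K) ∈ initialIdeal (Ideal.span (Set.range q)) := by
  classical
  have hspan : Ideal.span (Set.range fun j => projMap K n (q j)) =
      (Ideal.span (Set.range q)).map (projMap K n) := by
    rw [Ideal.map_span, ← Set.range_comp]
    rfl
  rw [hspan] at h
  obtain ⟨p, hp, hpμ⟩ := (Ideal.mem_map_iff_of_surjective _ projMap_surjective).1 h
  have hcoeff (ν : Fin n →₀ ℕ) : p.coeff (embExp ν) = if μ = ν then 1 else 0 := by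
    rw [← coeff_projMap, hpμ, coeff_monomial]
  have hlead : (homogeneousComponent μ.degree p).coeff (embExp μ) = 1 := by
    rw [coeff_homogeneousComponent, if_pos (degree_embExp μ), hcoeff, if_pos rfl]
  refine Ideal.subset_span ⟨homogeneousComponent μ.degree p,
    homogeneousComponent_mem_span q hq _ hp, fun h0 => ?_, embExp μ, ⟨?_, fun ν hν hne => ?_⟩, rfl⟩
  · rw [h0, coeff_zero] at hlead
    exact zero_ne_one hlead
  · rw [mem_support_iff, hlead]
    exact one_ne_zero
  · rw [mem_support_iff, coeff_homogeneousComponent, ite_ne_right_iff] at hν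
    refine Or.inr ⟨hν.1.trans (degree_embExp μ).symm, Fin.last n, ?_, fun j hj =>
      (hj.not_ge (Fin.le_last j)).elim⟩
    rw [embExp_last, Nat.pos_iff_ne_zero]
    intro h0
    obtain ⟨ν, rfl⟩ := exists_eq_embExp h0
    have := hν.2
    rw [hcoeff, ite_ne_right_iff] at this
    exact hne (congrArg embExp this.1.symm)

/-- if `d < δ`, then `B_{d+i} ⊆ in(I,g)` for every `i* < i ≤ δ − d`. -/
theorem stmt8 {F K : Type*} [Field F] [Field K] [Algebra F K] [Infinite K]
    {n : ℕ} (hn : 0 < n) (d : Fin n → ℕ) (hd : ∀ i, 1 ≤ d i) (hmono : Monotone d)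
    (D : ℕ) (hdD : ∀ i, d i ≤ D)
    (f : Fin n → MvPolynomial (Fin (n + 1)) K) (g : MvPolynomial (Fin (n + 1)) K)
    (hfg : IsGenericSeq F (Fin.snoc d D) (Fin.snoc f g))
    (I Ig : Ideal (MvPolynomial (Fin (n + 1)) K))
    (hI : I = Ideal.span (Set.range f)) (hIg : Ig = Ideal.span (Set.range (Fin.snoc f g)))
    (J : Ideal (MvPolynomial (Fin n) K)) (hJ : J = I.map (projMap K n))
    (δ istar : ℕ) (hδ : δ = (∑ j, d j) - n) (hDδ : D < δ) (histar : istar = (δ - D) / 2) :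
    ∀ i : ℕ, istar < i → i ≤ δ - D →
      ∀ μ ∈ stdMon J (D + i), monomial (embExp μ) (1 : K) ∈ initialIdeal Ig := by
  intro i hi _ μ hμ
  rw [hIg]
  refine monomial_embExp_mem_initialIdeal _ (fun j => ⟨_, hfg.1 j⟩) ?_
  let e : Fin (n + 1) → ℕ := Fin.snoc d D
  let B (j : Fin (n + 1)) : Finset (Fin (n + 1) × ℕ) := {j} ×ˢ Finset.range (e j)
  have hB (j) : (B j).card = e j := by simp [B]
  have hdisj : Pairwise fun i j => Disjoint (B i) (B j) := fun i j hij =>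
    Finset.disjoint_product.2 (Or.inl (Finset.disjoint_singleton.2 hij))
  have hsum : ∑ j, (B j).card = (∑ j, d j) + D := by
    simp [hB, e, Fin.sum_univ_castSucc]
  obtain ⟨a, ha⟩ := exists_prodLinearForms_containsForms (K := K) _ n B hdisj hsum (D + i)
    (by omega)
  refine containsForms_of_algebraicIndependent e _ (fun j => projMap_isHomogeneous (hfg.1 j))
    hfg.algebraicIndependent_projMap _ (fun j => ?_) ha _ (isHomogeneous_monomial _ hμ.1)
  rw [← hB j]
  exact prodLinearForms_isHomogeneous _ _
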